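/- The bilinear form q on M vanishes on the ideal I: q(a, c) = 0 and q(c, a) = 0 for all a ∈ M and c ∈ I. Consequently q descends to a well-defined bilinear form on the quotient A = M/I. -/

import Mathlib

open scoped TensorProduct DirectSum

noncomputable section

/-- The pure tensor `a₀ ⊗ a₁ ⊗ ⋯ ⊗ a_{m-1}` in the `m`-th tensor power. -/
def tp (A : Type) [AddCommGroup A] [Module ℂ A] (m : ℕ) (a : ℕ → A) : ⨂[ℂ]^m A :=
  PiTensorProduct.tprod ℂ (fun i : Fin m => a i.1)

/-- The space `M = ⊕_{k=1}^{p} A₁^{⊗k}`; the component of index `k : Fin p` is the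
tensor power of degree `k + 1`. -/
abbrev Mspace (p : ℕ) (A : Type) [AddCommGroup A] [Module ℂ A] : Type :=
  ⨁ k : Fin p, ⨂[ℂ]^(k.1 + 1) A

/-- Inclusion of the degree-`(k+1)` homogeneous component into `M`. -/
def incl (p : ℕ) (A : Type) [AddCommGroup A] [Module ℂ A] (k : Fin p) :
    (⨂[ℂ]^(k.1 + 1) A) →ₗ[ℂ] Mspace p A :=
  DirectSum.lof ℂ (Fin p) (fun k : Fin p => ⨂[ℂ]^(k.1 + 1) A) k

/-- The one-step substitution `id^{⊗r} ⊗ Γ ⊗ id^{⊗(n-2-r)}` followed by `Γ`, evaluated on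
a family of `2n−3` arguments; used to state the general associativity condition. -/
def gammaIns (n : ℕ) (A : Type) [AddCommGroup A] [Module ℂ A]
    (Γ : MultilinearMap ℂ (fun _ : Fin (n - 1) => A) A) (r : ℕ) (a : ℕ → A) : A :=
  Γ (fun i : Fin (n - 1) =>
    if i.1 < r then a i.1
    else if i.1 = r then Γ (fun j : Fin (n - 1) => a (r + j.1))
    else a (i.1 + (n - 2)))

/-- `mul` is the bilinear multiplication of `M = ⊕_{k=1}^{p} A₁^{⊗k}` determined on
homogeneous pure tensors `a = a₁⊗⋯⊗a_k`, `b = b₁⊗⋯⊗b_l` by: `a·b = a ⊗ b` if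
`k + l ≤ p`, and `a·b = Γ(a₁,…,a_k,b₁,…,b_{p+1−k}) ⊗ b_{p+2−k} ⊗ ⋯ ⊗ b_l` if
`k + l > p`. -/
def MulSpec (n p : ℕ) (A : Type) [AddCommGroup A] [Module ℂ A]
    (Γ : MultilinearMap ℂ (fun _ : Fin (n - 1) => A) A)
    (mul : Mspace p A →ₗ[ℂ] Mspace p A →ₗ[ℂ] Mspace p A) : Prop :=
  ∀ (k l : Fin p) (a b : ℕ → A),
    mul (incl p A k (tp A (k.1 + 1) a)) (incl p A l (tp A (l.1 + 1) b)) =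
      if h : (k.1 + 1) + (l.1 + 1) ≤ p then
        incl p A ⟨k.1 + l.1 + 1, by omega⟩
          (tp A (k.1 + l.1 + 1 + 1)
            (fun i => if i < k.1 + 1 then a i else b (i - (k.1 + 1))))
      else
        incl p A ⟨k.1 + l.1 + 1 - p, by have := k.isLt; have := l.isLt; omega⟩
          (tp A (k.1 + l.1 + 1 - p + 1)
            (fun i =>
              if i = 0 then
                Γ (fun j : Fin (n - 1) =>
                  if j.1 < k.1 + 1 then a j.1 else b (j.1 - (k.1 + 1)))
              else b (p - (k.1 + 1) + i)))

/-- The subspace `I_k ⊆ A₁^{⊗k}`: `I₁ = {0}`, and for `2 ≤ k ≤ p`,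
`I_k = {a : a·b = 0 for all b ∈ A₁^{⊗(p+1−k)}}`.  (The component of index `k : Fin p`
has degree `k + 1`.) -/
def Ik (p : ℕ) (A : Type) [AddCommGroup A] [Module ℂ A]
    (mul : Mspace p A →ₗ[ℂ] Mspace p A →ₗ[ℂ] Mspace p A) (k : Fin p) :
    Submodule ℂ (⨂[ℂ]^(k.1 + 1) A) :=
  if k.1 = 0 then ⊥
  else
    ⨅ y : ⨂[ℂ]^(p - (k.1 + 1) + 1) A,
      LinearMap.ker
        ((mul.flip (incl p A ⟨p - (k.1 + 1), by have := k.isLt; omega⟩ y)).comp (incl p A k))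

/-- The subspace `I = ⊕_{k=1}^{p} I_k ⊆ M`. -/
def Isub (p : ℕ) (A : Type) [AddCommGroup A] [Module ℂ A]
    (mul : Mspace p A →ₗ[ℂ] Mspace p A →ₗ[ℂ] Mspace p A) : Submodule ℂ (Mspace p A) :=
  ⨆ k : Fin p, (Ik p A mul k).map (incl p A k)

/-- `qM` is the bilinear form on `M` determined on homogeneous pure tensors
`a ∈ A₁^{⊗k}`, `b ∈ A₁^{⊗l}` by: `q(a,b) = 0` if `k + l ≢ 2 mod p`;
`q(a,b) = q₁(a₁, Γ(a₂,…,a_k,b₁,…,b_l))` if `k + l = n`; and `q(a,b) = q₁(a₁,b₁)` if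
`k = l = 1`. -/
def QSpec (n p : ℕ) (A : Type) [AddCommGroup A] [Module ℂ A]
    (Γ : MultilinearMap ℂ (fun _ : Fin (n - 1) => A) A)
    (q₁ : A →ₗ[ℂ] A →ₗ[ℂ] ℂ)
    (qM : Mspace p A →ₗ[ℂ] Mspace p A →ₗ[ℂ] ℂ) : Prop :=
  ∀ (k l : Fin p) (a b : ℕ → A),
    qM (incl p A k (tp A (k.1 + 1) a)) (incl p A l (tp A (l.1 + 1) b)) =
      if ((k.1 + 1) + (l.1 + 1)) % p = 2 % p then
        (if (k.1 + 1) + (l.1 + 1) = n then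
          q₁ (a 0) (Γ (fun j : Fin (n - 1) =>
            if j.1 + 1 < k.1 + 1 then a (j.1 + 1) else b (j.1 + 1 - (k.1 + 1))))
        else q₁ (a 0) (b 0))
      else 0

theorem tpow_ext (A : Type) [AddCommGroup A] [Module ℂ A] (m : ℕ) {N : Type} [AddCommGroup N]
    [Module ℂ N] (f g : (⨂[ℂ]^m A) →ₗ[ℂ] N) (h : ∀ a : ℕ → A, f (tp A m a) = g (tp A m a)) :
    f = g := by
  apply PiTensorProduct.ext
  apply MultilinearMap.ext
  intro v
  have := h (fun i => if h : i < m then v ⟨i, h⟩ else 0)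
  simpa [tp] using this

theorem mspace_ext (p : ℕ) (A : Type) [AddCommGroup A] [Module ℂ A] {N : Type} [AddCommGroup N]
    [Module ℂ N] (f g : Mspace p A →ₗ[ℂ] N)
    (h : ∀ (k : Fin p) (a : ℕ → A),
      f (incl p A k (tp A (k.1 + 1) a)) = g (incl p A k (tp A (k.1 + 1) a))) :
    f = g := by
  apply DirectSum.linearMap_ext
  intro k
  exact tpow_ext A (k.1 + 1) _ _ (fun a => h k a)

theorem cyc (n : ℕ) (hn : 3 ≤ n) (A : Type) [AddCommGroup A] [Module ℂ A]
    (Γ : MultilinearMap ℂ (fun _ : Fin (n - 1) => A) A)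
    (q₁ : A →ₗ[ℂ] A →ₗ[ℂ] ℂ)
    (hq₁symm : ∀ x y : A, q₁ x y = q₁ y x)
    (hinv : ∀ a : ℕ → A,
      q₁ (Γ (fun i : Fin (n - 1) => a i.1)) (a (n - 1)) =
        q₁ (a 0) (Γ (fun i : Fin (n - 1) => a (i.1 + 1)))) (a : ℕ → A) (r : ℕ) :
    q₁ (a (r % n)) (Γ (fun i : Fin (n - 1) => a ((i.1 + 1 + r) % n))) =
      q₁ (a 0) (Γ (fun i : Fin (n - 1) => a (i.1 + 1))) := by
  induction r with
  | zero =>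
    have h : ∀ i : Fin (n - 1), (i.1 + 1) % n = i.1 + 1 := fun i =>
      Nat.mod_eq_of_lt (by have := i.isLt; omega)
    simp [h]
  | succ r ih =>
    rw [← ih, hq₁symm (a (r % n))]
    have := hinv (fun i => a ((i + (r + 1)) % n))
    have e : (n - 1 + (r + 1)) % n = r % n := by
      rw [show n - 1 + (r + 1) = r + n by omega, Nat.add_mod_right]
    simp only [e, zero_add] at this
    rw [show (fun i : Fin (n - 1) => a ((i.1 + 1 + r) % n)) =
      (fun i : Fin (n - 1) => a ((i.1 + (r + 1)) % n)) from by
        funext i; rw [add_assoc, add_comm 1 r]]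
    exact this.symm

theorem qM_symm (n p : ℕ) (hn : 3 ≤ n) (hp : p = n - 2) (A : Type) [AddCommGroup A] [Module ℂ A]
    (Γ : MultilinearMap ℂ (fun _ : Fin (n - 1) => A) A)
    (q₁ : A →ₗ[ℂ] A →ₗ[ℂ] ℂ)
    (hq₁symm : ∀ x y : A, q₁ x y = q₁ y x)
    (hinv : ∀ a : ℕ → A,
      q₁ (Γ (fun i : Fin (n - 1) => a i.1)) (a (n - 1)) =
        q₁ (a 0) (Γ (fun i : Fin (n - 1) => a (i.1 + 1))))
    (qM : Mspace p A →ₗ[ℂ] Mspace p A →ₗ[ℂ] ℂ)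
    (hqM : QSpec n p A Γ q₁ qM) : qM = qM.flip := by
  apply mspace_ext
  intro k a
  apply mspace_ext
  intro l b
  rw [LinearMap.flip_apply, hqM, hqM, add_comm (l.1 + 1) (k.1 + 1)]
  split_ifs with h1 h2
  · have := cyc n hn A Γ q₁ hq₁symm hinv
      (fun i => if i < k.1 + 1 then a i else b (i - (k.1 + 1))) (k.1 + 1)
    have e : (k.1 + 1) % n = k.1 + 1 := Nat.mod_eq_of_lt (by omega)
    simp only [e, lt_irrefl, if_false, Nat.sub_self, Nat.succ_pos, if_true] at this
    rw [← this]
    congr 2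
    funext i
    have hi := i.isLt
    by_cases hc : i.1 + 1 < l.1 + 1
    · rw [if_pos hc, Nat.mod_eq_of_lt (by omega), if_neg (by omega)]
      congr 1; omega
    · rw [if_neg hc, show i.1 + 1 + (k.1 + 1) = (i.1 + 1 - (l.1 + 1)) + n by omega,
        Nat.add_mod_right, Nat.mod_eq_of_lt (by omega), if_pos (by omega)]
  · exact hq₁symm _ _
  · rfl

theorem qM_Ik (n p : ℕ) (hn : 3 ≤ n) (hp : p = n - 2) (A : Type) [AddCommGroup A] [Module ℂ A]
    (Γ : MultilinearMap ℂ (fun _ : Fin (n - 1) => A) A)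
    (q₁ : A →ₗ[ℂ] A →ₗ[ℂ] ℂ)
    (hinv : ∀ a : ℕ → A,
      q₁ (Γ (fun i : Fin (n - 1) => a i.1)) (a (n - 1)) =
        q₁ (a 0) (Γ (fun i : Fin (n - 1) => a (i.1 + 1))))
    (mul : Mspace p A →ₗ[ℂ] Mspace p A →ₗ[ℂ] Mspace p A)
    (hmul : MulSpec n p A Γ mul)
    (qM : Mspace p A →ₗ[ℂ] Mspace p A →ₗ[ℂ] ℂ)
    (hqM : QSpec n p A Γ q₁ qM) (k : Fin p) (c : ⨂[ℂ]^(k.1 + 1) A) (hc : c ∈ Ik p A mul k) :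
    qM (incl p A k c) = 0 := by
  unfold Ik at hc
  split_ifs at hc with hk
  · rw [(Submodule.mem_bot ℂ).1 hc, map_zero, map_zero]
  apply mspace_ext
  intro l b
  have hkp := k.isLt
  have hlp := l.isLt
  by_cases hs : (k.1 + 1) + (l.1 + 1) = n
  · have key : (qM.flip (incl p A l (tp A (l.1 + 1) b))).comp (incl p A k) =
        (qM.flip (incl p A ⟨0, by omega⟩ (tp A (0 + 1) (fun _ => b l.1)))).comp
          ((mul.flip (incl p A ⟨p - (k.1 + 1), by omega⟩ (tp A (p - (k.1 + 1) + 1) b))).comp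
            (incl p A k)) := by
      apply tpow_ext
      intro a
      simp only [LinearMap.comp_apply, LinearMap.flip_apply]
      rw [hmul k ⟨p - (k.1 + 1), by omega⟩, dif_neg (by simp only; omega), hqM, hqM]
      have e : k.1 + (p - (k.1 + 1)) + 1 - p = 0 := by omega
      simp only [e]
      rw [if_pos (by rw [hs, show n = 2 + p by omega, Nat.add_mod_right]), if_pos hs, if_pos trivial,
        if_neg (by omega), if_pos trivial]
      have := hinv (fun i => if i < k.1 + 1 then a i else b (i - (k.1 + 1)))
      rw [if_neg (by omega), if_pos (by omega), show n - 1 - (k.1 + 1) = l.1 by omega] at this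
      exact this.symm
    have h0 := (Submodule.mem_iInf _).1 hc (tp A (p - (k.1 + 1) + 1) b)
    have := LinearMap.congr_fun key c
    rw [LinearMap.comp_apply, LinearMap.comp_apply, LinearMap.mem_ker.1 h0, map_zero] at this
    simpa using this
  · have key : (qM.flip (incl p A l (tp A (l.1 + 1) b))).comp (incl p A k) = 0 := by
      apply tpow_ext
      intro a
      simp only [LinearMap.comp_apply, LinearMap.flip_apply]
      rw [hqM, if_neg]
      · rfl
      · intro h
        have h' : 2 ≡ (k.1 + 1) + (l.1 + 1) [MOD p] := h.symm
        rw [Nat.modEq_iff_dvd' (by omega)] at h'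
        obtain ⟨t, ht⟩ := h'
        rcases t with _ | _ | t
        · omega
        · omega
        · have : p * (t + 1 + 1) = p * t + p + p := by ring
          omega
    simpa using LinearMap.congr_fun key c

/-- The bilinear form `q` on `M` vanishes on the ideal `I`:
`q(a, c) = 0` and `q(c, a) = 0` for all `a ∈ M` and `c ∈ I`.  Consequently `q` descends
to a well-defined bilinear form on the quotient `A = M/I`. -/
theorem qM_vanishes_on_Isub_and_descends
    (n p : ℕ) (hn : 3 ≤ n) (hp : p = n - 2)
    (A : Type) [AddCommGroup A] [Module ℂ A] [FiniteDimensional ℂ A]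
    (Γ : MultilinearMap ℂ (fun _ : Fin (n - 1) => A) A)
    (q₁ : A →ₗ[ℂ] A →ₗ[ℂ] ℂ)
    (hq₁symm : ∀ x y : A, q₁ x y = q₁ y x)
    (hq₁nondeg : ∀ x : A, (∀ y : A, q₁ x y = 0) → x = 0)
    (hinv : ∀ a : ℕ → A,
      q₁ (Γ (fun i : Fin (n - 1) => a i.1)) (a (n - 1)) =
        q₁ (a 0) (Γ (fun i : Fin (n - 1) => a (i.1 + 1))))
    (hassoc : ∀ r s : ℕ, r ≤ n - 2 → s ≤ n - 2 → ∀ a : ℕ → A,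
      gammaIns n A Γ r a = gammaIns n A Γ s a)
    (mul : Mspace p A →ₗ[ℂ] Mspace p A →ₗ[ℂ] Mspace p A)
    (hmul : MulSpec n p A Γ mul)
    (qM : Mspace p A →ₗ[ℂ] Mspace p A →ₗ[ℂ] ℂ)
    (hqM : QSpec n p A Γ q₁ qM)
    :
    (∀ c ∈ Isub p A mul, ∀ a : Mspace p A, qM a c = 0 ∧ qM c a = 0) ∧
    (∃ qA : (Mspace p A ⧸ Isub p A mul) →ₗ[ℂ] (Mspace p A ⧸ Isub p A mul) →ₗ[ℂ] ℂ,
      ∀ a b : Mspace p A,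
        qA ((Isub p A mul).mkQ a) ((Isub p A mul).mkQ b) = qM a b) := by
  have hsym := qM_symm n p hn hp A Γ q₁ hq₁symm hinv qM hqM
  have hle : Isub p A mul ≤ LinearMap.ker qM := by
    refine iSup_le fun k => ?_
    rintro _ ⟨c, hc, rfl⟩
    exact LinearMap.mem_ker.2 (qM_Ik n p hn hp A Γ q₁ hinv mul hmul qM hqM k c hc)
  have hz : ∀ c ∈ Isub p A mul, ∀ a : Mspace p A, qM c a = 0 := by
    intro c hc a
    rw [LinearMap.mem_ker.1 (hle hc), LinearMap.zero_apply]
  have hz' : ∀ c ∈ Isub p A mul, ∀ a : Mspace p A, qM a c = 0 := by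
    intro c hc a
    rw [hsym, LinearMap.flip_apply]
    exact hz c hc a
  refine ⟨fun c hc a => ⟨hz' c hc a, hz c hc a⟩, ?_⟩
  let f := (Isub p A mul).liftQ qM hle
  have hf : Isub p A mul ≤ LinearMap.ker f.flip := by
    intro c hc
    rw [LinearMap.mem_ker]
    apply LinearMap.ext
    intro x
    obtain ⟨a, rfl⟩ := (Isub p A mul).mkQ_surjective x
    exact hz' c hc a
  exact ⟨((Isub p A mul).liftQ f.flip hf).flip, fun a b => rfl⟩
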